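/- Let S be a finite set of primes and for each p ∈ S let U_p ⊆ Z_p^d be measurable with boundary of measure zero. Then for any positive weight vector k, the weighted density of {a ∈ Z^d : a ∈ U_p for all p ∈ S} exists and equals ∏_{p∈S} μ(U_p). -/

import Mathlib

open Filter MeasureTheory

/-- The ring of `p`-adic integers, for `p` a member of the subtype of primes. -/
abbrev PrimePadicInt (p : Nat.Primes) : Type := @PadicInt p ⟨p.2⟩

noncomputable instance (p : Nat.Primes) : MeasurableSpace (PrimePadicInt p) := borel _

instance (p : Nat.Primes) : BorelSpace (PrimePadicInt p) := ⟨rfl⟩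

/-- The weighted density of a set `Z ⊆ ℤ^d` with respect to positive weights `k` is `L`. -/
def HasWeightedDensity (d : ℕ) (k : Fin d → ℝ) (Z : Set (Fin d → ℤ)) (L : ℝ) : Prop :=
  Tendsto (fun X : ℝ =>
      (Nat.card {a : Fin d → ℤ // a ∈ Z ∧ ∀ i, |(a i : ℝ)| ≤ X ^ (k i)} : ℝ) /
        (2 ^ d * X ^ (∑ i, k i)))
    atTop (nhds L)

lemma finite_setOf_abs_intCast_le (Y : ℝ) : {a : ℤ | |(a : ℝ)| ≤ Y}.Finite := by
  refine (Set.finite_Icc (-⌊Y⌋) ⌊Y⌋).subset fun a ha => ?_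
  have ha := abs_le.1 (show |(a : ℝ)| ≤ Y from ha)
  exact ⟨neg_le.1 (Int.le_floor.2 (by push_cast; linarith)), Int.le_floor.2 ha.2⟩

/-- Each residue class modulo `N` has density `1 / N` among the integers. -/
lemma tendsto_card_residue_class (N : ℕ) [NeZero N] (r : ZMod N) :
    Tendsto (fun Y : ℝ => (Nat.card {a : ℤ // (a : ZMod N) = r ∧ |(a : ℝ)| ≤ Y} : ℝ) / (2 * Y))
      atTop (nhds (N : ℝ)⁻¹) := by
  have hN : (0 : ℝ) < N := by exact_mod_cast NeZero.pos N
  have key : ∀ Y : ℝ, 0 ≤ Y →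
      |(Nat.card {a : ℤ // (a : ZMod N) = r ∧ |(a : ℝ)| ≤ Y} : ℝ) - 2 * Y / N| ≤ 1 / N + 1 := by
    intro Y hY
    obtain ⟨v, rfl⟩ := ZMod.intCast_surjective r
    have hcard : Nat.card {a : ℤ // (a : ZMod N) = v ∧ |(a : ℝ)| ≤ Y} =
        ((Finset.Ioc (-⌊Y⌋ - 1) ⌊Y⌋).filter (· ≡ v [ZMOD N])).card := by
      rw [← Nat.card_eq_finsetCard]
      refine Nat.card_congr (Equiv.subtypeEquivRight fun a => ?_)
      rw [Finset.mem_filter, Finset.mem_Ioc, ZMod.intCast_eq_intCast_iff, and_comm, abs_le,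
        Int.le_floor, neg_le, ← Int.cast_neg, ← Int.le_floor]
      refine and_congr_left' (and_congr_left' ?_)
      omega
    have hc := Int.Ioc_filter_modEq_card (-⌊Y⌋ - 1) ⌊Y⌋ (r := N)
      (by exact_mod_cast NeZero.pos N) v
    rw [hcard]
    generalize ((Finset.Ioc (-⌊Y⌋ - 1) ⌊Y⌋).filter (· ≡ v [ZMOD N])).card = c at hc
    have hfl : 0 ≤ ⌊Y⌋ := Int.floor_nonneg.2 hY
    have hNQ : (0 : ℚ) < N := by exact_mod_cast NeZero.pos N
    have hdiff : ((⌊Y⌋ : ℤ) - v : ℚ) / N - ((-⌊Y⌋ - 1 : ℤ) - v : ℚ) / N = (2 * ⌊Y⌋ + 1) / N := by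
      push_cast
      ring
    simp only [Int.cast_natCast] at hc
    set x : ℚ := ((⌊Y⌋ : ℤ) - v : ℚ) / N
    set y : ℚ := ((-⌊Y⌋ - 1 : ℤ) - v : ℚ) / N
    have hpos : (0 : ℚ) ≤ (2 * ⌊Y⌋ + 1) / N := by positivity
    rw [max_eq_left (sub_nonneg.2 (Int.floor_mono (by linarith)))] at hc
    have hcQ : (c : ℚ) = ⌊x⌋ - ⌊y⌋ := by exact_mod_cast hc
    have hub : (c : ℚ) ≤ (2 * ⌊Y⌋ + 1) / N + 1 := by
      linarith [Int.floor_le x, Int.lt_floor_add_one y]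
    have hlb : ((2 * ⌊Y⌋ + 1) / N - 1 : ℚ) ≤ c := by
      linarith [Int.floor_le y, Int.lt_floor_add_one x]
    have hub' : (c : ℝ) ≤ (2 * ⌊Y⌋ + 1) / N + 1 := by exact_mod_cast hub
    have hlb' : ((2 * ⌊Y⌋ + 1) / N - 1 : ℝ) ≤ c := by exact_mod_cast hlb
    have h₁ : (2 * ⌊Y⌋ + 1 : ℝ) / N ≤ 2 * Y / N + 1 / N := by
      rw [← add_div]
      gcongr
      exact Int.floor_le Y
    have h₂ : 2 * Y / N - 1 / N ≤ (2 * ⌊Y⌋ + 1 : ℝ) / N := by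
      rw [← sub_div]
      gcongr
      linarith [Int.lt_floor_add_one Y]
    rw [abs_le]
    constructor <;> linarith
  have hzero : Tendsto (fun Y : ℝ =>
      (Nat.card {a : ℤ // (a : ZMod N) = r ∧ |(a : ℝ)| ≤ Y} : ℝ) / (2 * Y) - (N : ℝ)⁻¹)
      atTop (nhds 0) := by
    refine squeeze_zero_norm' (a := fun Y : ℝ => (1 / N + 1) / (2 * Y)) ?_
      ((tendsto_id.const_mul_atTop two_pos).const_div_atTop _)
    filter_upwards [eventually_gt_atTop 0] with Y hY
    have : ∀ c : ℝ, c / (2 * Y) - (N : ℝ)⁻¹ = (c - 2 * Y / N) / (2 * Y) := by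
      intro c
      field_simp
    rw [this, Real.norm_eq_abs, abs_div, abs_of_pos (by positivity : 0 < 2 * Y)]
    gcongr
    exact key Y hY.le
  simpa using hzero.add_const (N : ℝ)⁻¹

/-- A set defined by residues modulo `N` has the expected weighted density. -/
lemma hasWeightedDensity_residues (d : ℕ) (k : Fin d → ℝ) (hk : ∀ i, 0 < k i) (N : ℕ) [NeZero N]
    (T : Set (Fin d → ZMod N)) :
    HasWeightedDensity d k {a | (fun i => (a i : ZMod N)) ∈ T} (T.ncard / (N : ℝ) ^ d) := by
  classical
  have hfin : ∀ (Y : ℝ) (r : ZMod N), Finite {a : ℤ // (a : ZMod N) = r ∧ |(a : ℝ)| ≤ Y} :=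
    fun Y r => (finite_setOf_abs_intCast_le Y).subset fun a ha => ha.2
  have hcard : ∀ X : ℝ, Nat.card {a : Fin d → ℤ //
        (fun i => (a i : ZMod N)) ∈ T ∧ ∀ i, |(a i : ℝ)| ≤ X ^ (k i)} =
      ∑ t : T, ∏ i, Nat.card {a : ℤ // (a : ZMod N) = t.1 i ∧ |(a : ℝ)| ≤ X ^ (k i)} := by
    intro X
    let e : {a : Fin d → ℤ //
        (fun i => (a i : ZMod N)) ∈ T ∧ ∀ i, |(a i : ℝ)| ≤ X ^ (k i)} ≃
        Σ t : T, ∀ i, {a : ℤ // (a : ZMod N) = t.1 i ∧ |(a : ℝ)| ≤ X ^ (k i)} :=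
      { toFun := fun a => ⟨⟨_, a.2.1⟩, fun i => ⟨a.1 i, rfl, a.2.2 i⟩⟩
        invFun := fun s => ⟨fun i => (s.2 i).1, by
          have : (fun i => ((s.2 i).1 : ZMod N)) = s.1.1 := funext fun i => (s.2 i).2.1
          simp only [this, s.1.2, true_and]
          exact fun i => (s.2 i).2.2⟩
        left_inv := fun a => rfl
        right_inv := by
          rintro ⟨⟨t, ht⟩, f⟩
          obtain ⟨a, ha, rfl⟩ : ∃ (a : Fin d → ℤ) (ha : ∀ i, (a i : ZMod N) = t i ∧
              |(a i : ℝ)| ≤ X ^ (k i)), f = fun i => ⟨a i, ha i⟩ :=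
            ⟨fun i => (f i).1, fun i => (f i).2, rfl⟩
          obtain rfl : (fun i => (a i : ZMod N)) = t := funext fun i => (ha i).1
          rfl }
    rw [Nat.card_congr e, Nat.card_sigma]
    simp_rw [Nat.card_pi]
  have hlim : Tendsto (fun X : ℝ => ∑ t : T, ∏ i,
      (Nat.card {a : ℤ // (a : ZMod N) = t.1 i ∧ |(a : ℝ)| ≤ X ^ (k i)} : ℝ) / (2 * X ^ (k i)))
      atTop (nhds (∑ _t : T, ∏ _i : Fin d, (N : ℝ)⁻¹)) :=
    tendsto_finsetSum _ fun t _ => tendsto_finsetProd _ fun i _ =>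
      (tendsto_card_residue_class N (t.1 i)).comp (tendsto_rpow_atTop (hk i))
  have hvalue : (T.ncard / (N : ℝ) ^ d) = ∑ _t : T, ∏ _i : Fin d, (N : ℝ)⁻¹ := by
    rw [Finset.prod_const, Finset.sum_const, Finset.card_univ, Finset.card_univ, Fintype.card_fin,
      nsmul_eq_mul, inv_pow, div_eq_mul_inv, ← Nat.card_eq_fintype_card, Nat.card_coe_set_eq]
  rw [HasWeightedDensity, hvalue]
  refine hlim.congr' ?_
  filter_upwards [eventually_gt_atTop 0] with X hX
  rw [hcard, Real.rpow_sum_of_pos hX, Nat.cast_sum, Finset.sum_div]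
  refine Finset.sum_congr rfl fun t _ => ?_
  rw [Finset.prod_div_distrib, Finset.prod_mul_distrib]
  simp

/-- A set sandwiched between sets whose weighted densities tend to `L` has weighted density `L`. -/
lemma HasWeightedDensity.squeeze {d : ℕ} {k : Fin d → ℝ} {Z : Set (Fin d → ℤ)} {L : ℝ}
    {Z₁ Z₂ : ℕ → Set (Fin d → ℤ)} {L₁ L₂ : ℕ → ℝ}
    (h₁ : ∀ n, HasWeightedDensity d k (Z₁ n) (L₁ n))
    (h₂ : ∀ n, HasWeightedDensity d k (Z₂ n) (L₂ n))
    (hsub₁ : ∀ n, Z₁ n ⊆ Z) (hsub₂ : ∀ n, Z ⊆ Z₂ n)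
    (hL₁ : Tendsto L₁ atTop (nhds L)) (hL₂ : Tendsto L₂ atTop (nhds L)) :
    HasWeightedDensity d k Z L := by
  have hmono : ∀ (A B : Set (Fin d → ℤ)) (X : ℝ), 0 < X → A ⊆ B →
      (Nat.card {a : Fin d → ℤ // a ∈ A ∧ ∀ i, |(a i : ℝ)| ≤ X ^ (k i)} : ℝ) /
        (2 ^ d * X ^ (∑ i, k i)) ≤
      (Nat.card {a : Fin d → ℤ // a ∈ B ∧ ∀ i, |(a i : ℝ)| ≤ X ^ (k i)} : ℝ) /
        (2 ^ d * X ^ (∑ i, k i)) := by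
    intro A B X hX hAB
    have hfin : Set.Finite {a : Fin d → ℤ | a ∈ B ∧ ∀ i, |(a i : ℝ)| ≤ X ^ (k i)} :=
      (Set.Finite.pi' fun i => finite_setOf_abs_intCast_le (X ^ k i)).subset fun a ha => ha.2
    have : Nat.card {a : Fin d → ℤ // a ∈ A ∧ ∀ i, |(a i : ℝ)| ≤ X ^ (k i)} ≤
        Nat.card {a : Fin d → ℤ // a ∈ B ∧ ∀ i, |(a i : ℝ)| ≤ X ^ (k i)} :=
      Nat.card_mono hfin fun a ha => ⟨hAB ha.1, ha.2⟩
    gcongr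
  refine tendsto_order.2 ⟨fun l hl => ?_, fun u hu => ?_⟩
  · obtain ⟨n, hn⟩ := ((tendsto_order.1 hL₁).1 l hl).exists
    filter_upwards [(tendsto_order.1 (h₁ n)).1 l hn, eventually_gt_atTop 0] with X hX hX0
    exact hX.trans_le (hmono _ _ X hX0 (hsub₁ n))
  · obtain ⟨n, hn⟩ := ((tendsto_order.1 hL₂).2 u hu).exists
    filter_upwards [(tendsto_order.1 (h₂ n)).2 u hn, eventually_gt_atTop 0] with X hX hX0
    exact (hmono _ _ X hX0 (hsub₂ n)).trans_lt hX

/-- An invariant probability measure equidistributes over the fibers of a surjection onto a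
finite group. -/
lemma measureReal_preimage_of_surjective {G A : Type*} [AddGroup G] [MeasurableSpace G]
    [MeasurableAdd G] [AddGroup A] [Finite A] (μ : Measure G) [μ.IsAddLeftInvariant]
    [IsProbabilityMeasure μ] (f : G →+ A) (hf : Function.Surjective f)
    (hm : ∀ a, MeasurableSet (f ⁻¹' {a})) (T : Set A) :
    μ.real (f ⁻¹' T) = T.ncard / Nat.card A := by
  classical
  cases nonempty_fintype A
  have hconst : ∀ a, μ.real (f ⁻¹' {a}) = μ.real (f ⁻¹' {0}) := by
    intro a
    obtain ⟨g, rfl⟩ := hf a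
    have : (fun x => g + x) ⁻¹' (f ⁻¹' {f g}) = f ⁻¹' {0} := by
      ext x; simp
    rw [← this, measureReal_def, measureReal_def, measure_preimage_add]
  have hsum : ∀ T : Finset A, μ.real (f ⁻¹' T) = T.card * μ.real (f ⁻¹' {0}) := by
    intro T
    rw [← sum_measureReal_preimage_singleton T fun a _ => hm a]
    simp [hconst]
  have h1 := hsum Finset.univ
  simp only [Finset.coe_univ, Set.preimage_univ, probReal_univ, Finset.card_univ] at h1
  have h0 : (Fintype.card A : ℝ) ≠ 0 := by positivity
  have h2 := hsum T.toFinset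
  rw [Set.coe_toFinset] at h2
  rw [h2, Set.ncard_eq_toFinset_card', Nat.card_eq_fintype_card, eq_div_iff h0, mul_assoc,
    mul_comm (μ.real _), ← h1, mul_one]

/-- A set with null frontier is exhausted, up to measure zero, by the fibers contained in it, when
the fibers form neighbourhood bases. -/
lemma tendsto_measureReal_fibers_subset {G : Type*} [TopologicalSpace G] [MeasurableSpace G]
    {A : ℕ → Type*} (μ : Measure G) [IsFiniteMeasure μ] (f : ∀ n, G → A n)
    (hanti : ∀ x, Antitone fun n => f n ⁻¹' {f n x})
    (hf : ∀ x, (nhds x).HasBasis (fun _ : ℕ => True) fun n => f n ⁻¹' {f n x})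
    {U : Set G} (hU : μ (frontier U) = 0) :
    Tendsto (fun n => μ.real (f n ⁻¹' {t | f n ⁻¹' {t} ⊆ U})) atTop (nhds (μ.real U)) := by
  have hmono : Monotone fun n => f n ⁻¹' {t | f n ⁻¹' {t} ⊆ U} :=
    fun m n hmn x hx => (hanti x hmn).trans hx
  have hUnion : ⋃ n, f n ⁻¹' {t | f n ⁻¹' {t} ⊆ U} = interior U := by
    ext x
    simp [mem_interior_iff_mem_nhds, (hf x).mem_iff]
  have := tendsto_measure_iUnion_atTop (μ := μ) hmono
  rw [hUnion, measure_interior_of_null_frontier hU] at this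
  exact (ENNReal.tendsto_toReal (measure_ne_top μ U)).comp this

lemma toZModPow_eq_iff {p : ℕ} [Fact p.Prime] (n : ℕ) (x y : ℤ_[p]) :
    PadicInt.toZModPow n x = PadicInt.toZModPow n y ↔ dist x y ≤ (p : ℝ) ^ (-n : ℤ) := by
  rw [dist_eq_norm, PadicInt.norm_le_pow_iff_mem_span_pow, ← PadicInt.ker_toZModPow,
    RingHom.mem_ker, map_sub, sub_eq_zero]

/-- Coordinatewise reduction modulo `p ^ n`. -/
noncomputable def reduction (p : ℕ) [Fact p.Prime] (d n : ℕ) :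
    (Fin d → ℤ_[p]) →+ (Fin d → ZMod (p ^ n)) :=
  (PadicInt.toZModPow n).toAddMonoidHom.compLeft (Fin d)

lemma reduction_fiber_eq_closedBall (p : ℕ) [Fact p.Prime] (d n : ℕ) (x : Fin d → ℤ_[p]) :
    reduction p d n ⁻¹' {reduction p d n x} = Metric.closedBall x ((p : ℝ) ^ (-n : ℤ)) := by
  ext y
  rw [Metric.mem_closedBall, dist_pi_le_iff (by positivity)]
  simp [reduction, funext_iff, toZModPow_eq_iff]

lemma reduction_surjective (p : ℕ) [Fact p.Prime] (d n : ℕ) :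
    Function.Surjective (reduction p d n) :=
  (ZMod.ringHom_surjective (PadicInt.toZModPow (p := p) n)).comp_left

lemma antitone_reduction_fiber (p : ℕ) [Fact p.Prime] (d : ℕ) (x : Fin d → ℤ_[p]) :
    Antitone fun n => reduction p d n ⁻¹' {reduction p d n x} := by
  intro m n hmn
  have : (1 : ℝ) ≤ p := by exact_mod_cast (Fact.out : p.Prime).one_le
  simp only [reduction_fiber_eq_closedBall]
  exact Metric.closedBall_subset_closedBall (zpow_le_zpow_right₀ this (by omega))

lemma hasBasis_nhds_reduction_fiber (p : ℕ) [Fact p.Prime] (d : ℕ) (x : Fin d → ℤ_[p]) :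
    (nhds x).HasBasis (fun _ : ℕ => True) fun n => reduction p d n ⁻¹' {reduction p d n x} := by
  have : (0 : ℝ) < p := by exact_mod_cast (Fact.out : p.Prime).pos
  simp only [reduction_fiber_eq_closedBall]
  refine Metric.nhds_basis_closedBall.to_hasBasis (fun ε hε => ?_) fun n _ => ?_
  · obtain ⟨n, hn⟩ := PadicInt.exists_pow_neg_lt p hε
    exact ⟨n, trivial, Metric.closedBall_subset_closedBall hn.le⟩
  · exact ⟨_, by positivity, subset_rfl⟩

/-- Residue conditions modulo pairwise coprime moduli are independent. -/
lemma hasWeightedDensity_coprime_residues {ι : Type*} [Fintype ι] (d : ℕ) (k : Fin d → ℝ)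
    (hk : ∀ i, 0 < k i) (m : ι → ℕ) [∀ j, NeZero (m j)]
    (hm : Pairwise (Function.onFun Nat.Coprime m))
    (T : ∀ j, Set (Fin d → ZMod (m j))) :
    HasWeightedDensity d k {a | ∀ j, (fun i => (a i : ZMod (m j))) ∈ T j}
      (∏ j, (T j).ncard / (m j : ℝ) ^ d) := by
  have : NeZero (∏ j, m j) := ⟨Finset.prod_ne_zero_iff.2 fun j _ => NeZero.ne _⟩
  let e := ZMod.prodEquivPi m hm
  let E : (Fin d → ZMod (∏ j, m j)) ≃ ∀ j, Fin d → ZMod (m j) :=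
    (Equiv.arrowCongr (Equiv.refl _) e.toEquiv).trans (Equiv.piComm _)
  have hcard : (E ⁻¹' Set.univ.pi T).ncard = ∏ j, (T j).ncard := by
    rw [Set.ncard_preimage_of_injective_subset_range E.injective (by simp),
      ← Nat.card_coe_set_eq, Nat.card_congr (Equiv.Set.univPi T), Nat.card_pi]
    rfl
  convert! hasWeightedDensity_residues d k hk (∏ j, m j) (E ⁻¹' Set.univ.pi T) using 1
  · ext a
    have hE : ∀ j, E (fun i => (a i : ZMod (∏ j, m j))) j = fun i => (a i : ZMod (m j)) := by
      intro j
      funext i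
      change e (a i : ZMod (∏ j, m j)) j = _
      rw [map_intCast, Pi.intCast_apply]
    simp [Set.mem_pi, hE]
  · rw [hcard, Finset.prod_div_distrib, Nat.cast_prod, Nat.cast_prod, Finset.prod_pow]

lemma measurableSet_reduction_preimage (p : Nat.Primes) (d n : ℕ)
    (T : Set (Fin d → ZMod ((p : ℕ) ^ n))) :
    haveI : Fact (p : ℕ).Prime := ⟨p.2⟩
    MeasurableSet (α := Fin d → PrimePadicInt p) (reduction p d n ⁻¹' T) := by
  have : Fact (p : ℕ).Prime := ⟨p.2⟩
  rw [← Set.biUnion_preimage_singleton]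
  refine T.toFinite.measurableSet_biUnion fun t _ => ?_
  obtain ⟨x, rfl⟩ := reduction_surjective p d n t
  rw [reduction_fiber_eq_closedBall]
  exact Metric.isClosed_closedBall.measurableSet

lemma measureReal_reduction_preimage (p : Nat.Primes) (d : ℕ)
    (μ : Measure (Fin d → PrimePadicInt p)) [μ.IsAddLeftInvariant] [IsProbabilityMeasure μ] (n : ℕ)
    (T : Set (Fin d → ZMod ((p : ℕ) ^ n))) :
    haveI : Fact (p : ℕ).Prime := ⟨p.2⟩
    μ.real (reduction p d n ⁻¹' T) = T.ncard / (((p : ℕ) ^ n : ℕ) : ℝ) ^ d := by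
  have : Fact (p : ℕ).Prime := ⟨p.2⟩
  rw [measureReal_preimage_of_surjective μ (reduction p d n) (reduction_surjective p d n)
    fun t => measurableSet_reduction_preimage p d n {t}, Nat.card_pi]
  simp

/-- Let `S` be a finite set of primes and for each `p ∈ S` let `U p ⊆ ℤ_p^d` be measurable with
boundary of Haar measure zero. Then for any positive weight vector `k`, the weighted density of
`{a ∈ ℤ^d : a ∈ U p for all p ∈ S}` exists and equals `∏_{p ∈ S} μ_p (U p)`, where `μ_p` is
the normalized Haar measure on `ℤ_p^d`. -/
theorem weighted_density_of_finitely_many_padic_conditions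
    (d : ℕ) (S : Finset Nat.Primes) (k : Fin d → ℝ) (hk : ∀ i, 0 < k i)
    (U : ∀ p : Nat.Primes, Set (Fin d → PrimePadicInt p))
    (μ : ∀ p : Nat.Primes, Measure (Fin d → PrimePadicInt p))
    (hHaar : ∀ p ∈ S, (μ p).IsAddHaarMeasure)
    (hprob : ∀ p ∈ S, μ p Set.univ = 1)
    (hmeas : ∀ p ∈ S, MeasurableSet (U p))
    (hbdry : ∀ p ∈ S, μ p (frontier (U p)) = 0) :
    HasWeightedDensity d k
      {a : Fin d → ℤ | ∀ p ∈ S, (fun i => ((a i : ℤ) : PrimePadicInt p)) ∈ U p}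
      (∏ p ∈ S, (μ p (U p)).toReal) := by
  have hfact : ∀ p : Nat.Primes, Fact (p : ℕ).Prime := fun p => ⟨p.2⟩
  let inner (V : ∀ p : Nat.Primes, Set (Fin d → PrimePadicInt p)) (p : Nat.Primes) (n : ℕ) :
      Set (Fin d → ZMod ((p : ℕ) ^ n)) := {t | reduction p d n ⁻¹' {t} ⊆ V p}
  have hdens : ∀ (n : ℕ) (T : ∀ p : Nat.Primes, Set (Fin d → ZMod ((p : ℕ) ^ n))),
      HasWeightedDensity d k {a | ∀ p : S, (fun i => (a i : ZMod ((p : ℕ) ^ n))) ∈ T p}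
        (∏ p ∈ S, (μ p).real (reduction p d n ⁻¹' T p)) := by
    intro n T
    convert! hasWeightedDensity_coprime_residues d k hk (fun p : S => ((p : Nat.Primes) : ℕ) ^ n) ?_
      (fun p : S => T p) using 1
    · rw [← Finset.prod_coe_sort]
      refine Finset.prod_congr rfl fun p _ => ?_
      have := hHaar p p.2
      have : IsProbabilityMeasure (μ p) := ⟨hprob p p.2⟩
      exact measureReal_reduction_preimage p d (μ p) n _
    · intro p q hpq
      refine Nat.Coprime.pow _ _ ((Nat.coprime_primes p.1.2 q.1.2).2 fun h => hpq ?_)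
      exact Subtype.ext (Subtype.ext h)
  have hinner : ∀ (V : ∀ p : Nat.Primes, Set (Fin d → PrimePadicInt p)),
      ∀ p ∈ S, μ p (frontier (V p)) = 0 →
      Tendsto (fun n => (μ p).real (reduction p d n ⁻¹' inner V p n)) atTop
        (nhds ((μ p).real (V p))) := by
    intro V p hp hV
    have : IsProbabilityMeasure (μ p) := ⟨hprob p hp⟩
    exact tendsto_measureReal_fibers_subset (μ p) (fun n => reduction p d n)
      (antitone_reduction_fiber p d) (hasBasis_nhds_reduction_fiber p d) hV
  have hred : ∀ (p : Nat.Primes) (n : ℕ) (a : Fin d → ℤ),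
      reduction p d n (fun i => (a i : PrimePadicInt p)) =
        fun i => (a i : ZMod ((p : ℕ) ^ n)) := by
    intro p n a
    funext i
    exact map_intCast (PadicInt.toZModPow (p := p) n) (a i)
  refine HasWeightedDensity.squeeze (fun n => hdens n fun p => inner U p n)
    (fun n => hdens n fun p => (inner (fun p => (U p)ᶜ) p n)ᶜ) ?_ ?_ ?_ ?_
  · intro n a ha p hp
    have := ha ⟨p, hp⟩
    simp only [← hred] at this
    exact this rfl
  · intro n a ha p hmem
    simp only [← hred] at hmem
    exact hmem rfl (ha p p.2)
  · exact tendsto_finsetProd _ fun p hp => hinner U p hp (hbdry p hp)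
  · refine tendsto_finsetProd _ fun p hp => ?_
    have := hHaar p hp
    have : IsProbabilityMeasure (μ p) := ⟨hprob p hp⟩
    have := (hinner (fun p => (U p)ᶜ) p hp (by rw [frontier_compl]; exact hbdry p hp)).const_sub 1
    rw [probReal_compl_eq_one_sub (hmeas p hp), sub_sub_cancel] at this
    refine this.congr fun n => ?_
    rw [Set.preimage_compl, probReal_compl_eq_one_sub (measurableSet_reduction_preimage p d n _)]
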